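/- Let α be a symbol of the graph group G_F, let p be an α-peak, and let a, a' ∈ G be such that p ≤ ap, p ≤ a'p, and α occurs in p⁻¹a'p. If |p| ≥ 8|a|³, then each conjugate of a has a segment s satisfying #_α(p⁻¹aps⁻¹) ≤ 2|a'|². -/

import Mathlib

open Pointwise

namespace GraphGroupPaper

/-- The set of commutator relators: `gᵢ` and `gⱼ` commute for every pair of distinct
`i, j` with `{i,j} ∉ F`. -/
def Rels (k : ℕ) (F : Set (Sym2 (Fin k))) : Set (FreeGroup (Fin k)) :=
  {w | ∃ i j : Fin k, i ≠ j ∧ s(i, j) ∉ F ∧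
      w = FreeGroup.of i * FreeGroup.of j * (FreeGroup.of i)⁻¹ * (FreeGroup.of j)⁻¹}

/-- The graph group `G_F` with generators `g₁, …, g_k` and relations `gᵢgⱼ = gⱼgᵢ`
for all distinct `i, j` with `{i,j} ∉ F`. -/
abbrev Grp (k : ℕ) (F : Set (Sym2 (Fin k))) := PresentedGroup (Rels k F)

/-- The generator `gᵢ` of the graph group. -/
def gen (k : ℕ) (F : Set (Sym2 (Fin k))) (i : Fin k) : Grp k F :=
  PresentedGroup.of i

/-- The group element corresponding to a symbol: `(i, true)` stands for `gᵢ`,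
`(i, false)` stands for `gᵢ⁻¹`. -/
def sym (k : ℕ) (F : Set (Sym2 (Fin k))) (α : Fin k × Bool) : Grp k F :=
  if α.2 then gen k F α.1 else (gen k F α.1)⁻¹

/-- The product of the word `l` of symbols, as an element of the graph group. -/
def wordProd (k : ℕ) (F : Set (Sym2 (Fin k))) (l : List (Fin k × Bool)) : Grp k F :=
  (l.map (sym k F)).prod

/-- `|x|` : the length of a shortest word in the symbols representing `x`. -/
noncomputable def len {k : ℕ} {F : Set (Sym2 (Fin k))} (x : Grp k F) : ℕ :=
  sInf {n | ∃ l : List (Fin k × Bool), wordProd k F l = x ∧ l.length = n}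

/-- The partial order on `G_F`:  `x ≤ y` iff `|y| = |x| + |x⁻¹y|`. -/
def le {k : ℕ} {F : Set (Sym2 (Fin k))} (x y : Grp k F) : Prop :=
  len y = len x + len (x⁻¹ * y)

/-- `m` is the meet `x ∧ y` (greatest lower bound w.r.t. `le`). -/
def IsMeet {k : ℕ} {F : Set (Sym2 (Fin k))} (x y m : Grp k F) : Prop :=
  le m x ∧ le m y ∧ ∀ w, le w x → le w y → le w m

/-- `j` is the (finite) join `x ∨ y` (least upper bound w.r.t. `le`);
`x ∨ y` is finite iff such a `j` exists. -/
def IsJoin {k : ℕ} {F : Set (Sym2 (Fin k))} (x y j : Grp k F) : Prop :=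
  le x j ∧ le y j ∧ ∀ w, le x w → le y w → le j w

/-- `j` is the (finite) join of the set `S`. -/
def IsJoinSet {k : ℕ} {F : Set (Sym2 (Fin k))} (S : Set (Grp k F)) (j : Grp k F) : Prop :=
  (∀ s ∈ S, le s j) ∧ ∀ w, (∀ s ∈ S, le s w) → le j w

/-- `y` is a segment of `a` if `a = x·y·z` for some `x, z`. -/
def Segment {k : ℕ} {F : Set (Sym2 (Fin k))} (y a : Grp k F) : Prop :=
  ∃ x z, a = x * y * z ∧ len a = len x + len y + len z

/-- The left-invariant metric `dist(x,y) = |x⁻¹y|`. -/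
noncomputable def dist {k : ℕ} {F : Set (Sym2 (Fin k))} (x y : Grp k F) : ℕ :=
  len (x⁻¹ * y)

/-- A nonempty set `L` is convex if `x, z ∈ L` and `dist(x,y) + dist(y,z) = dist(x,z)`
imply `y ∈ L`. -/
def ConvexSet {k : ℕ} {F : Set (Sym2 (Fin k))} (L : Set (Grp k F)) : Prop :=
  L.Nonempty ∧ ∀ x z y : Grp k F, x ∈ L → z ∈ L →
    dist x y + dist y z = dist x z → y ∈ L

/-- An ideal: nonempty, downward closed, and closed under finite joins. -/
def IdealSet {k : ℕ} {F : Set (Sym2 (Fin k))} (I : Set (Grp k F)) : Prop :=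
  I.Nonempty ∧ (∀ x ∈ I, ∀ y, le y x → y ∈ I) ∧
    (∀ x ∈ I, ∀ y ∈ I, ∀ j, IsJoin x y j → j ∈ I)

/-- `H` is closed if both `H` and `H⁻¹` are ideals. -/
def ClosedSet {k : ℕ} {F : Set (Sym2 (Fin k))} (H : Set (Grp k F)) : Prop :=
  IdealSet H ∧ IdealSet H⁻¹

/-- `m` is a minimal element of `S` w.r.t. `le`. -/
def MinimalIn {k : ℕ} {F : Set (Sym2 (Fin k))} (S : Set (Grp k F)) (m : Grp k F) : Prop :=
  m ∈ S ∧ ∀ x ∈ S, le x m → x = m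

/-- `l` is a reduced (i.e. shortest) word representing `x`. -/
def MinWord {k : ℕ} {F : Set (Sym2 (Fin k))} (x : Grp k F) (l : List (Fin k × Bool)) : Prop :=
  wordProd k F l = x ∧ l.length = len x

open Classical in
/-- `#_α(x)`: the number of occurrences of the symbol `α` (not counting `α⁻¹`)
in a reduced word representing `x`. -/
noncomputable def symCount {k : ℕ} {F : Set (Sym2 (Fin k))} (α : Fin k × Bool)
    (x : Grp k F) : ℕ :=
  if h : ∃ l, MinWord x l then h.choose.count α else 0

/-- The symbol `α` occurs in `x`. -/
def Occurs {k : ℕ} {F : Set (Sym2 (Fin k))} (α : Fin k × Bool) (x : Grp k F) : Prop :=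
  0 < symCount α x

/-- `α` is a maximal symbol of `x`, i.e. `xα⁻¹ ≤ x`. -/
def MaxSym {k : ℕ} {F : Set (Sym2 (Fin k))} (α : Fin k × Bool) (x : Grp k F) : Prop :=
  le (x * (sym k F α)⁻¹) x

/-- A peak: an element with precisely one maximal symbol. -/
def IsPeak {k : ℕ} {F : Set (Sym2 (Fin k))} (p : Grp k F) : Prop :=
  ∃! α : Fin k × Bool, MaxSym α p

/-- An `α`-peak: a peak whose unique maximal symbol is `α`. -/
def AlphaPeak {k : ℕ} {F : Set (Sym2 (Fin k))} (α : Fin k × Bool) (p : Grp k F) : Prop :=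
  MaxSym α p ∧ ∀ β, MaxSym β p → β = α

/-- The set of generator indices occurring in `b`. -/
def Support {k : ℕ} {F : Set (Sym2 (Fin k))} (b : Grp k F) : Set (Fin k) :=
  {i | Occurs (i, true) b ∨ Occurs (i, false) b}

/-- `b` is connected: the generators occurring in `b` induce a connected subgraph of
the graph `([k], F)`. -/
def Conn {k : ℕ} {F : Set (Sym2 (Fin k))} (b : Grp k F) : Prop :=
  (SimpleGraph.induce (Support b) (SimpleGraph.fromEdgeSet F)).Connected

/-- `b` is cyclically reduced: `b ∧ b⁻¹ = 1`. -/
def CycRed {k : ℕ} {F : Set (Sym2 (Fin k))} (b : Grp k F) : Prop :=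
  IsMeet b b⁻¹ 1

section

variable {k : ℕ} {F : Set (Sym2 (Fin k))}

/-! ### Words and length -/

/-- The inverse symbol. -/
def invSym (σ : Fin k × Bool) : Fin k × Bool := (σ.1, !σ.2)

@[simp] lemma invSym_invSym (σ : Fin k × Bool) : invSym (invSym σ) = σ := by simp [invSym]

@[simp] lemma invSym_fst (σ : Fin k × Bool) : (invSym σ).1 = σ.1 := rfl

@[simp] lemma sym_invSym (σ : Fin k × Bool) : sym k F (invSym σ) = (sym k F σ)⁻¹ := by
  obtain ⟨i, _ | _⟩ := σ <;> simp [sym, invSym]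

@[simp] lemma wordProd_nil : wordProd k F [] = 1 := rfl

@[simp] lemma wordProd_cons (σ : Fin k × Bool) (l : List (Fin k × Bool)) :
    wordProd k F (σ :: l) = sym k F σ * wordProd k F l := by simp [wordProd]

@[simp] lemma wordProd_append (l m : List (Fin k × Bool)) :
    wordProd k F (l ++ m) = wordProd k F l * wordProd k F m := by simp [wordProd]

lemma wordProd_inv (l : List (Fin k × Bool)) :
    wordProd k F (l.map invSym).reverse = (wordProd k F l)⁻¹ := by
  induction l with
  | nil => simp
  | cons σ l ih => simp [ih]

lemma exists_wordProd (x : Grp k F) : ∃ l, wordProd k F l = x := by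
  have h : x ∈ Subgroup.closure (Set.range (PresentedGroup.of (rels := Rels k F))) := by simp
  induction h using Subgroup.closure_induction with
  | mem x hx => obtain ⟨i, rfl⟩ := hx; exact ⟨[(i, true)], by simp [sym, gen]⟩
  | one => exact ⟨[], rfl⟩
  | mul x y _ _ hx hy =>
    obtain ⟨l, rfl⟩ := hx; obtain ⟨m, rfl⟩ := hy; exact ⟨l ++ m, by simp⟩
  | inv x _ hx => obtain ⟨l, rfl⟩ := hx; exact ⟨_, wordProd_inv l⟩

lemma exists_minWord (x : Grp k F) : ∃ l, MinWord x l := by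
  obtain ⟨l, hl⟩ := exists_wordProd x
  exact Nat.sInf_mem (s := {n | ∃ l : List (Fin k × Bool), wordProd k F l = x ∧ l.length = n})
    ⟨_, l, hl, rfl⟩

lemma len_wordProd_le (l : List (Fin k × Bool)) : len (wordProd k F l) ≤ l.length :=
  Nat.sInf_le ⟨l, rfl, rfl⟩

@[simp] lemma len_one : len (1 : Grp k F) = 0 := by
  simpa using len_wordProd_le (F := F) []

lemma len_mul_le (x y : Grp k F) : len (x * y) ≤ len x + len y := by
  obtain ⟨l, rfl, hl⟩ := exists_minWord x
  obtain ⟨m, rfl, hm⟩ := exists_minWord y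
  simpa [← hl, ← hm] using len_wordProd_le (F := F) (l ++ m)

lemma len_inv_le (x : Grp k F) : len x⁻¹ ≤ len x := by
  obtain ⟨l, rfl, hl⟩ := exists_minWord x
  simpa [← hl, wordProd_inv] using len_wordProd_le (F := F) (l.map invSym).reverse

@[simp] lemma len_inv (x : Grp k F) : len x⁻¹ = len x :=
  (len_inv_le x).antisymm (by simpa using len_inv_le x⁻¹)

lemma len_sym_le (σ : Fin k × Bool) : len (sym k F σ) ≤ 1 := by
  simpa using len_wordProd_le (F := F) [σ]

lemma len_pow_le (x : Grp k F) (n : ℕ) : len (x ^ n) ≤ n * len x := by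
  induction n with
  | zero => simp
  | succ n ih => rw [pow_succ, add_mul, one_mul]; exact (len_mul_le _ _).trans (by omega)

/-- Prefixes and suffixes of a reduced word are reduced. -/
lemma MinWord.of_append {l m : List (Fin k × Bool)} {x : Grp k F} (h : MinWord x (l ++ m)) :
    MinWord (wordProd k F l) l ∧ MinWord (wordProd k F m) m := by
  have h1 := len_wordProd_le (F := F) l
  have h2 := len_wordProd_le (F := F) m
  have h3 := len_mul_le (wordProd k F l) (wordProd k F m)
  obtain ⟨h4, h5⟩ := h
  rw [wordProd_append] at h4
  simp only [List.length_append] at h5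
  subst h4
  exact ⟨⟨rfl, by omega⟩, ⟨rfl, by omega⟩⟩

lemma dist_triangle (x y z : Grp k F) : dist x z ≤ dist x y + dist y z := by
  simpa [dist, mul_assoc] using len_mul_le (x⁻¹ * y) (y⁻¹ * z)

lemma dist_comm (x y : Grp k F) : dist x y = dist y x := by
  simpa [dist] using (len_inv (x⁻¹ * y)).symm

@[simp] lemma dist_mul_left (t x y : Grp k F) : dist (t * x) (t * y) = dist x y := by
  simp [dist, mul_assoc]

/-! ### Standard subgroups -/

lemma gen_commute {i j : Fin k} (h : j ≠ i ∧ s(i, j) ∉ F) :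
    gen k F i * gen k F j = gen k F j * gen k F i := by
  have := PresentedGroup.one_of_mem (rels := Rels k F) ⟨i, j, h.1.symm, h.2, rfl⟩
  simp only [map_mul, map_inv] at this
  exact (mul_inv_eq_iff_eq_mul.mp (mul_inv_eq_one.mp this))

open Classical in
/-- The retraction of the graph group onto the subgroup generated by the `gen j`, `j ∈ S`. -/
noncomputable def retract (S : Set (Fin k)) : Grp k F →* Grp k F :=
  PresentedGroup.toGroup (f := fun j => if j ∈ S then gen k F j else 1) <| by
    rintro r ⟨i, j, hij, hF, rfl⟩
    have : gen k F i * gen k F j * (gen k F i)⁻¹ * (gen k F j)⁻¹ = 1 := by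
      rw [gen_commute ⟨hij.symm, hF⟩]; group
    by_cases hi : i ∈ S <;> by_cases hj : j ∈ S <;> simp [hi, hj, this]

open Classical in
lemma retract_wordProd (S : Set (Fin k)) (l : List (Fin k × Bool)) :
    retract S (wordProd k F l) = wordProd k F (l.filter fun σ => σ.1 ∈ S) := by
  have key (j : Fin k) : retract (F := F) S (gen k F j) = if j ∈ S then gen k F j else 1 :=
    PresentedGroup.toGroup.of _
  induction l with
  | nil => simp
  | cons σ l ih =>
    obtain ⟨j, _ | _⟩ := σ <;> by_cases hj : j ∈ S <;> simp [sym, hj, ih, key]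

/-- The subgroup generated by the generators that commute with `g_i` and differ from `g_i`. -/
def linkGrp (F : Set (Sym2 (Fin k))) (i : Fin k) : Subgroup (Grp k F) :=
  Subgroup.closure (gen k F '' {j | j ≠ i ∧ s(i, j) ∉ F})

lemma sym_mem_linkGrp {i : Fin k} {σ : Fin k × Bool} (h : σ.1 ≠ i ∧ s(i, σ.1) ∉ F) :
    sym k F σ ∈ linkGrp F i := by
  have : gen k F σ.1 ∈ linkGrp F i := Subgroup.subset_closure ⟨_, h, rfl⟩
  unfold sym; split_ifs
  · exact this
  · exact inv_mem this

lemma wordProd_mem_linkGrp {i : Fin k} {l : List (Fin k × Bool)}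
    (h : ∀ σ ∈ l, σ.1 ≠ i ∧ s(i, σ.1) ∉ F) : wordProd k F l ∈ linkGrp F i := by
  induction l with
  | nil => exact one_mem _
  | cons σ l ih =>
    rw [wordProd_cons]
    exact mul_mem (sym_mem_linkGrp (h σ (by simp))) (ih fun τ hτ => h τ (by simp [hτ]))

lemma sym_commute {α : Fin k × Bool} {c : Grp k F} (hc : c ∈ linkGrp F α.1) :
    Commute (sym k F α) c := by
  induction hc using Subgroup.closure_induction with
  | mem x hx =>
    obtain ⟨j, hj, rfl⟩ := hx
    have : Commute (gen k F α.1) (gen k F j) := gen_commute hj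
    unfold sym; split_ifs
    · exact this
    · exact this.inv_left
  | one => exact Commute.one_right _
  | mul x y _ _ hx hy => exact hx.mul_right hy
  | inv x _ hx => exact hx.inv_right

/-- Deleting the letters outside the link from a word of an element of `linkGrp`. -/
lemma exists_sublist_of_mem_linkGrp {i : Fin k} {l : List (Fin k × Bool)}
    (h : wordProd k F l ∈ linkGrp F i) : ∃ m : List (Fin k × Bool), m.Sublist l ∧
      wordProd k F m = wordProd k F l ∧ ∀ σ ∈ m, σ.1 ≠ i ∧ s(i, σ.1) ∉ F := by
  classical
  have key : ∀ c ∈ linkGrp F i, retract {j | j ≠ i ∧ s(i, j) ∉ F} c = c := by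
    intro c hc
    induction hc using Subgroup.closure_induction with
    | mem x hx =>
      obtain ⟨j, hj, rfl⟩ := hx
      exact (PresentedGroup.toGroup.of _).trans (if_pos hj)
    | one => simp
    | mul x y _ _ hx hy => simp [hx, hy]
    | inv x _ hx => simp [hx]
  refine ⟨_, List.filter_sublist, (retract_wordProd {j | j ≠ i ∧ s(i, j) ∉ F} l).symm.trans
    (key _ h), ?_⟩
  intro σ hσ
  simpa using (List.mem_filter.mp hσ).2

lemma MinWord.forall_link {i : Fin k} {l : List (Fin k × Bool)} {c : Grp k F}
    (h : MinWord c l) (hc : c ∈ linkGrp F i) : ∀ σ ∈ l, σ.1 ≠ i ∧ s(i, σ.1) ∉ F := by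
  obtain ⟨rfl, hl⟩ := h
  obtain ⟨m, hm, hml, hs⟩ := exists_sublist_of_mem_linkGrp hc
  have := len_wordProd_le (F := F) m
  rw [hml] at this
  rwa [← hm.eq_of_length_le (by omega)]

lemma mem_linkGrp_of_len_mul {i : Fin k} {x y : Grp k F} (h : len (x * y) = len x + len y)
    (hc : x * y ∈ linkGrp F i) : x ∈ linkGrp F i := by
  obtain ⟨l, rfl, hl⟩ := exists_minWord x
  obtain ⟨m, rfl, hm⟩ := exists_minWord y
  have hw : MinWord (wordProd k F l * wordProd k F m) (l ++ m) := ⟨by simp, by simp; omega⟩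
  exact wordProd_mem_linkGrp fun σ hσ => hw.forall_link hc σ (by simp [hσ])

/-! ### Half-spaces -/

open Classical in
/-- Left multiplication by `gen j`, with a second coordinate that changes when the inverse of the
first one crosses the wall of the standard edge labelled `i`. -/
noncomputable def wallPerm (F : Set (Sym2 (Fin k))) (i j : Fin k) :
    Equiv.Perm (Grp k F × Bool) where
  toFun x := (gen k F j * x.1, xor x.2 (decide (j = i ∧ gen k F j * x.1 ∈ linkGrp F i)))
  invFun x := ((gen k F j)⁻¹ * x.1, xor x.2 (decide (j = i ∧ x.1 ∈ linkGrp F i)))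
  left_inv x := by simp
  right_inv x := by simp

lemma wallPerm_commute (i : Fin k) {a b : Fin k} (hab : a ≠ b) (hF : s(a, b) ∉ F) :
    wallPerm F i a * wallPerm F i b = wallPerm F i b * wallPerm F i a := by
  have hc := gen_commute (F := F) ⟨hab.symm, hF⟩
  ext x
  · simp [wallPerm, ← mul_assoc, hc]
  · by_cases ha : a = i
    · subst ha
      have hb : gen k F b ∈ linkGrp F a := Subgroup.subset_closure ⟨b, ⟨hab.symm, hF⟩, rfl⟩
      simp [wallPerm, hab.symm, ← mul_assoc, hc]
      simp [mul_assoc, Subgroup.mul_mem_cancel_left _ hb]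
    · by_cases hb : b = i
      · subst hb
        have hb : gen k F a ∈ linkGrp F b :=
          Subgroup.subset_closure ⟨a, ⟨hab, by rwa [Sym2.eq_swap]⟩, rfl⟩
        simp [wallPerm, ha, ← mul_assoc, ← hc]
        simp [mul_assoc, Subgroup.mul_mem_cancel_left _ hb]
      · simp [wallPerm, ha, hb]

/-- The action of the graph group extending `wallPerm`. -/
noncomputable def wallHom (F : Set (Sym2 (Fin k))) (i : Fin k) :
    Grp k F →* Equiv.Perm (Grp k F × Bool) :=
  PresentedGroup.toGroup (f := wallPerm F i) <| by
    rintro r ⟨a, b, hab, hF, rfl⟩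
    simp [wallPerm_commute i hab hF]

lemma wallHom_gen (i j : Fin k) : wallHom F i (gen k F j) = wallPerm F i j :=
  PresentedGroup.toGroup.of _

lemma wallHom_fst (i : Fin k) (g : Grp k F) (x : Grp k F × Bool) :
    (wallHom F i g x).1 = g * x.1 := by
  obtain ⟨l, rfl⟩ := exists_wordProd g
  induction l with
  | nil => simp
  | cons σ l ih =>
    obtain ⟨j, _ | _⟩ := σ
    · simp [sym, wallHom_gen, mul_assoc, ← ih, wallPerm, Equiv.Perm.inv_def]
    · simp [sym, wallHom_gen, mul_assoc, ← ih, wallPerm]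

/-- The side of the wall of the edge from `1` to `gen i` on which `g` lies. -/
noncomputable def side (i : Fin k) (g : Grp k F) : Bool := (wallHom F i g⁻¹ (1, false)).2

lemma side_one (i : Fin k) : side i (1 : Grp k F) = false := by simp [side]

open Classical in
lemma side_mul_gen (i j : Fin k) (g : Grp k F) :
    side i (g * gen k F j) = xor (side i g) (decide (j = i ∧ g ∈ linkGrp F i)) := by
  have h1 := wallHom_fst i g⁻¹ (1, false)
  have h2 : wallHom F i (gen k F j)⁻¹ = (wallPerm F i j)⁻¹ := by rw [map_inv, wallHom_gen]
  simp only [side, mul_inv_rev, map_mul (wallHom F i), Equiv.Perm.mul_apply, h2]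
  generalize wallHom F i g⁻¹ (1, false) = x at *
  simp [wallPerm, Equiv.Perm.inv_def, h1]

open Classical in
lemma side_mul_gen_inv (i j : Fin k) (g : Grp k F) :
    side i g = xor (side i (g * (gen k F j)⁻¹))
      (decide (j = i ∧ g * (gen k F j)⁻¹ ∈ linkGrp F i)) := by
  simpa using side_mul_gen i j (g * (gen k F j)⁻¹)

lemma side_mem {i : Fin k} {c : Grp k F} (hc : c ∈ linkGrp F i) : side i c = false := by
  obtain ⟨l, rfl, hl⟩ := exists_minWord c
  have := MinWord.forall_link ⟨rfl, hl⟩ hc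
  clear hl hc
  induction l using List.reverseRecOn with
  | nil => exact side_one i
  | append_singleton l σ ih =>
    have hσ := this σ (by simp)
    have ih := ih fun τ hτ => this τ (by simp [hτ])
    obtain ⟨j, _ | _⟩ := σ
    · have := side_mul_gen_inv i j (wordProd k F l)
      simpa [sym, ih, show j ≠ i from hσ.1] using this.symm
    · have := side_mul_gen i j (wordProd k F l)
      simpa [sym, ih, show j ≠ i from hσ.1] using this

/-- The half-space containing `g` and bounded by the wall of the edge from `g * α⁻¹` to `g`. -/
def Half (α : Fin k × Bool) (g : Grp k F) : Set (Grp k F) :=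
  {y | if α.2 then side α.1 (gen k F α.1 * (g⁻¹ * y)) = true else side α.1 (g⁻¹ * y) = false}

variable {α : Fin k × Bool}

lemma mem_half_iff {g y : Grp k F} : y ∈ Half α g ↔ g⁻¹ * y ∈ Half α 1 := by simp [Half]

@[simp] lemma mul_mem_half {t g y : Grp k F} : t * y ∈ Half α (t * g) ↔ y ∈ Half α g := by
  simp [Half, mul_assoc]

lemma mem_half_invSym {g y : Grp k F} :
    y ∈ Half (invSym α) (g * (sym k F α)⁻¹) ↔ y ∉ Half α g := by
  obtain ⟨i, _ | _⟩ := α <;> simp [Half, invSym, sym, mul_assoc]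

lemma mem_half_of_mem {g y : Grp k F} (h : g⁻¹ * y ∈ linkGrp F α.1) : y ∈ Half α g := by
  obtain ⟨i, _ | _⟩ := α
  · simpa [Half] using side_mem h
  · have := sym_commute (α := (i, true)) h
    simp only [sym, if_true] at this
    rw [Half, Set.mem_ofPred_eq, if_pos rfl, this.eq, side_mul_gen, side_mem h]
    simpa using h

lemma self_mem_half (g : Grp k F) : g ∈ Half α g := mem_half_of_mem (by simp)

lemma notMem_half_of_mem {g y : Grp k F} (h : g⁻¹ * y * sym k F α ∈ linkGrp F α.1) :
    y ∉ Half α g := by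
  rw [← mem_half_invSym]
  apply mem_half_of_mem
  have := (sym_commute h).eq
  have h2 : (g * (sym k F α)⁻¹)⁻¹ * y = g⁻¹ * y * sym k F α := by
    calc _ = sym k F α * (g⁻¹ * y * sym k F α) * (sym k F α)⁻¹ := by group
      _ = _ := by rw [this]; group
  rw [h2]; exact h

lemma self_mul_inv_notMem_half (g : Grp k F) : g * (sym k F α)⁻¹ ∉ Half α g :=
  notMem_half_of_mem (by simp)

/-- An edge entering a half-space crosses its wall. -/
lemma eq_of_enter {σ : Fin k × Bool} {g y : Grp k F} (h1 : y ∉ Half α g)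
    (h2 : y * sym k F σ ∈ Half α g) : σ = α ∧ g⁻¹ * y * sym k F α ∈ linkGrp F α.1 := by
  rw [mem_half_iff] at h1 h2
  rw [← mul_assoc] at h2
  generalize g⁻¹ * y = y at *
  obtain ⟨i, _ | _⟩ := α <;> obtain ⟨j, _ | _⟩ := σ <;> simp [Half, sym] at h1 h2 ⊢
  · have := side_mul_gen_inv i j y
    simp [h1, h2] at this
    obtain ⟨rfl, h⟩ := this
    exact ⟨rfl, h⟩
  · rw [side_mul_gen, h1] at h2
    simp only [Bool.true_bne, Bool.not_eq_false', decide_eq_true_eq] at h2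
    simp [side_mem h2.2] at h1
  · have := side_mul_gen_inv i j (gen k F i * y)
    rw [mul_assoc, h2, h1] at this
    simp only [Bool.true_bne, Bool.false_eq, Bool.not_eq_false',
      decide_eq_true_eq] at this
    simp [side_mem this.2] at h2
  · rw [← mul_assoc, side_mul_gen, h1] at h2
    simp at h2
    obtain ⟨rfl, h⟩ := h2
    have := (sym_commute (α := (j, true)) h).eq
    simp only [sym, if_true] at this
    rw [← mul_right_inj (gen k F j)] at this
    refine ⟨rfl, ?_⟩
    have e : y * gen k F j = gen k F j * y := by
      apply mul_left_cancel (a := gen k F j)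
      apply mul_left_cancel (a := gen k F j)
      simpa [mul_assoc] using this.symm
    rw [e]; exact h

/-- A path entering a half-space crosses its wall. -/
lemma exists_cross {g y : Grp k F} {l : List (Fin k × Bool)} (h1 : y ∉ Half α g)
    (h2 : y * wordProd k F l ∈ Half α g) : ∃ l₁ l₂, ∃ c ∈ linkGrp F α.1,
      l = l₁ ++ α :: l₂ ∧ y * wordProd k F l₁ * sym k F α = g * c := by
  induction l generalizing y with
  | nil => simp [h1] at h2
  | cons σ l ih =>
    rw [wordProd_cons, ← mul_assoc] at h2
    by_cases h : y * sym k F σ ∈ Half α g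
    · obtain ⟨rfl, hc⟩ := eq_of_enter h1 h
      exact ⟨[], l, _, hc, rfl, by simp [mul_assoc]⟩
    · obtain ⟨l₁, l₂, c, hc, rfl, e⟩ := ih h h2
      exact ⟨σ :: l₁, l₂, c, hc, rfl, by simpa [mul_assoc] using e⟩

lemma conj_mem_linkGrp {c : Grp k F} (hc : c ∈ linkGrp F α.1) :
    sym k F α * c * (sym k F α)⁻¹ = c := by
  rw [(sym_commute hc).eq]; group

lemma dist_wall {g c d : Grp k F} (hc : c ∈ linkGrp F α.1) (hd : d ∈ linkGrp F α.1) :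
    dist (g * c * (sym k F α)⁻¹) (g * d * (sym k F α)⁻¹) = dist (g * c) (g * d) := by
  have := conj_mem_linkGrp (mul_mem (inv_mem hc) hd)
  simp only [dist, mul_inv_rev, inv_inv, mul_assoc, inv_mul_cancel_left] at this ⊢
  rw [this]

lemma cross_dist {g y v : Grp k F} (h1 : y ∉ Half α g) (h2 : v ∈ Half α g) :
    ∃ c ∈ linkGrp F α.1,
      dist y v = dist y (g * c * (sym k F α)⁻¹) + 1 + dist (g * c) v := by
  obtain ⟨l, hl, hlen⟩ := exists_minWord (y⁻¹ * v)
  obtain ⟨l₁, l₂, c, hc, rfl, e⟩ := exists_cross h1 (by rw [hl]; simpa using h2)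
  refine ⟨c, hc, ?_⟩
  have e1 : wordProd k F l₁ = y⁻¹ * (g * c * (sym k F α)⁻¹) := by rw [← e]; group
  have e2 : wordProd k F l₂ = (g * c)⁻¹ * v := by
    rw [← e, eq_inv_mul_iff_mul_eq, ← mul_right_inj y⁻¹, ← hl]; simp [mul_assoc]
  have h3 := len_wordProd_le (F := F) l₁
  have h4 := len_wordProd_le (F := F) l₂
  have h5 := dist_triangle y (g * c * (sym k F α)⁻¹) v
  have h6 := dist_triangle (g * c * (sym k F α)⁻¹) (g * c) v
  have h7 : dist (g * c * (sym k F α)⁻¹) (g * c) ≤ 1 := by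
    simpa [dist, mul_assoc] using len_sym_le (F := F) α
  rw [e1] at h3
  rw [e2] at h4
  simp only [List.length_append, List.length_cons] at hlen
  unfold dist at *
  omega

lemma dist_of_mem_half {g y : Grp k F} (h : y ∈ Half α g) :
    dist (g * (sym k F α)⁻¹) y = dist g y + 1 := by
  obtain ⟨c, hc, e⟩ := cross_dist (self_mul_inv_notMem_half g) h
  have h1 := dist_wall (g := g) (one_mem _) hc
  rw [mul_one] at h1
  have h2 := dist_triangle g (g * c) y
  have h3 := dist_triangle (g * (sym k F α)⁻¹) g y
  have h4 : dist (g * (sym k F α)⁻¹) g ≤ 1 := by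
    simpa [dist] using len_sym_le (F := F) α
  omega

lemma dist_of_notMem_half {g y : Grp k F} (h : y ∉ Half α g) :
    dist g y = dist (g * (sym k F α)⁻¹) y + 1 := by
  simpa using dist_of_mem_half (mem_half_invSym.mpr h)

/-- Complements of half-spaces are convex. -/
lemma notMem_half_of_between {g y v z : Grp k F} (hy : y ∉ Half α g) (hz : z ∉ Half α g)
    (h : dist y v + dist v z = dist y z) : v ∉ Half α g := by
  intro hv
  obtain ⟨c, hc, e⟩ := cross_dist hy hv
  obtain ⟨d, hd, e'⟩ := cross_dist hz hv
  have h1 := dist_wall (g := g) hc hd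
  have h2 := dist_triangle (g * c) v (g * d)
  have h3 := dist_triangle y (g * c * (sym k F α)⁻¹) z
  have h4 := dist_triangle (g * c * (sym k F α)⁻¹) (g * d * (sym k F α)⁻¹) z
  rw [dist_comm z, dist_comm z, dist_comm (g * d)] at e'
  omega

/-- Half-spaces are convex. -/
lemma mem_half_of_between {g y v z : Grp k F} (hy : y ∈ Half α g) (hz : z ∈ Half α g)
    (h : dist y v + dist v z = dist y z) : v ∈ Half α g := by
  by_contra hv
  refine notMem_half_of_between ?_ ?_ h (mem_half_invSym.mpr hv) <;>
  rw [mem_half_invSym, not_not] <;> assumption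

lemma cross_between {g y v : Grp k F} (h1 : y ∉ Half α g) (h2 : v ∈ Half α g) :
    ∃ c ∈ linkGrp F α.1,
      dist y (g * c * (sym k F α)⁻¹) + dist (g * c * (sym k F α)⁻¹) v = dist y v ∧
      dist y (g * c) + dist (g * c) v = dist y v := by
  obtain ⟨c, hc, e⟩ := cross_dist h1 h2
  have h5 := dist_triangle y (g * c * (sym k F α)⁻¹) v
  have h6 := dist_triangle (g * c * (sym k F α)⁻¹) (g * c) v
  have h7 : dist (g * c * (sym k F α)⁻¹) (g * c) ≤ 1 := by
    simpa [dist, mul_assoc] using len_sym_le (F := F) α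
  have h8 := dist_triangle y (g * c) v
  have h9 := dist_triangle y (g * c * (sym k F α)⁻¹) (g * c)
  exact ⟨c, hc, by omega, by omega⟩

lemma half_mul_right {g c : Grp k F} (hc : c ∈ linkGrp F α.1) :
    Half α (g * c) = Half α g := by
  have key : ∀ (g c y : Grp k F), c ∈ linkGrp F α.1 → y ∈ Half α (g * c) → y ∈ Half α g := by
    intro g c y hc hy
    by_contra h
    obtain ⟨d, hd, e, -⟩ := cross_between h (mem_half_of_mem (by simpa using hc) : g * c ∈ _)
    refine notMem_half_of_mem ?_ (mem_half_of_between hy (self_mem_half _) e)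
    simpa [mul_assoc] using mul_mem (inv_mem hc) hd
  ext y
  exact ⟨key g c y hc, fun h => key (g * c) c⁻¹ y (inv_mem hc) (by simpa using h)⟩

lemma half_eq_of_mem {g g' : Grp k F} (h : g⁻¹ * g' ∈ linkGrp F α.1) :
    Half α g' = Half α g := by
  simpa using half_mul_right (g := g) h

lemma mul_mem_half_right {g y c : Grp k F} (hc : c ∈ linkGrp F α.1) :
    y * c ∈ Half α g ↔ y ∈ Half α g := by
  have key : ∀ (y c : Grp k F), c ∈ linkGrp F α.1 → y * c ∈ Half α g → y ∈ Half α g := by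
    intro y c hc h
    by_contra hy
    obtain ⟨l, hl⟩ := exists_minWord c
    obtain ⟨l₁, l₂, d, -, rfl, -⟩ := exists_cross hy (by rwa [hl.1])
    exact (hl.forall_link hc α (by simp)).1 rfl
  exact ⟨key y c hc, fun h => key (y * c) c⁻¹ (inv_mem hc) (by simpa using h)⟩

/-- If `g` lies in a half-space but just outside it one leaves the half-space, it is on the wall. -/
lemma inv_mul_mem_of_exit {g y : Grp k F} (h1 : y * (sym k F α)⁻¹ ∉ Half α g)
    (h2 : y ∈ Half α g) : g⁻¹ * y ∈ linkGrp F α.1 := by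
  simpa [mul_assoc] using (eq_of_enter h1 (σ := α) (by simpa using h2)).2

/-- Half-spaces with a common point in the complement are nested. -/
lemma half_subset_half {g g' o : Grp k F} (hg : g' ∈ Half α g) (ho : o ∉ Half α g)
    (ho' : o ∉ Half α g') : Half α g' ⊆ Half α g := by
  intro y hy
  by_contra hyg
  obtain ⟨c, hc, -, e⟩ := cross_between ho' hy
  exact notMem_half_of_between ho hyg e ((mul_mem_half_right hc).mpr hg)

/-- Let two half-spaces have a common point. If some point lies in neither, they are nested. -/
lemma mem_half_or_mem_half {g g' o e : Grp k F} (ho : o ∉ Half α g)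
    (he : e ∈ Half α g) (he' : e ∈ Half α g') : g' ∈ Half α g ∨ g ∈ Half α g' := by
  by_contra! h
  obtain ⟨c, hc, -, -⟩ := cross_between ho he
  have h1 : g * c ∉ Half α g' := by rw [mul_mem_half_right hc]; exact h.2
  obtain ⟨d, hd, -, e1⟩ := cross_between h1 he'
  have := mem_half_of_between ((mul_mem_half_right hc).mpr (self_mem_half g)) he e1
  rw [mul_mem_half_right hd] at this
  exact h.1 this

/-! ### Elements that are shortest in their coset of `linkGrp` -/

lemma link_invSym {i : Fin k} {σ : Fin k × Bool} (h : σ.1 ≠ i ∧ s(i, σ.1) ∉ F) :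
    (invSym σ).1 ≠ i ∧ s(i, (invSym σ).1) ∉ F := h

lemma len_mul_sym_of_mem {q : Grp k F} {σ : Fin k × Bool} (h : q⁻¹ ∈ Half (invSym σ) 1) :
    len (q * sym k F σ) = len q + 1 := by
  have := dist_of_mem_half h
  rw [dist_comm, dist_comm 1] at this
  simpa [dist] using this

lemma mem_of_len_lt_len_mul_sym {q : Grp k F} {σ : Fin k × Bool}
    (h : len q ≤ len (q * sym k F σ)) : q⁻¹ ∈ Half (invSym σ) 1 := by
  by_contra hq
  have := dist_of_notMem_half hq
  rw [dist_comm, dist_comm _ q⁻¹] at this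
  simp [dist] at this
  omega

/-- `q` is a shortest element of its coset `q * linkGrp F i`. -/
def Shortest (i : Fin k) (q : Grp k F) : Prop :=
  ∀ σ : Fin k × Bool, σ.1 ≠ i ∧ s(i, σ.1) ∉ F → q⁻¹ ∈ Half σ 1

lemma Shortest.of_le {i : Fin k} {q : Grp k F} (h : ∀ c ∈ linkGrp F i, len q ≤ len (q * c)) :
    Shortest i q := by
  intro σ hσ
  simpa using mem_of_len_lt_len_mul_sym (h _ (sym_mem_linkGrp (link_invSym hσ)))

lemma AlphaPeak.shortest {p : Grp k F} (hp : AlphaPeak α p) : Shortest α.1 p := by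
  intro σ hσ
  by_contra h
  have h1 := dist_of_notMem_half h
  rw [dist_comm, dist_comm _ p⁻¹] at h1
  simp only [dist, inv_inv, mul_one, one_mul] at h1
  refine hσ.1 (congrArg Prod.fst (hp.2 σ ?_))
  have h2 := len_mul_le (p * (sym k F σ)⁻¹) (sym k F σ)
  have h3 := len_sym_le (F := F) σ
  simp only [MaxSym, le, mul_inv_rev, inv_inv, inv_mul_cancel_right] at *
  omega

lemma AlphaPeak.inv_notMem {p : Grp k F} (hp : AlphaPeak α p) : p⁻¹ ∉ Half α 1 := by
  intro h
  have h1 := dist_of_mem_half h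
  rw [dist_comm, dist_comm _ p⁻¹] at h1
  have h2 : le _ _ := hp.1
  simp [le, dist] at h1 h2
  omega

lemma Shortest.len_mul {i : Fin k} {q c : Grp k F} (hq : Shortest i q) (hc : c ∈ linkGrp F i) :
    len (q * c) = len q + len c := by
  obtain ⟨l, hl⟩ := exists_minWord c
  have hlink := hl.forall_link hc
  obtain ⟨rfl, hlen⟩ := hl
  clear hc
  induction l using List.reverseRecOn with
  | nil => simp
  | append_singleton l σ ih =>
    have hmin := MinWord.of_append (x := wordProd k F (l ++ [σ])) ⟨rfl, hlen⟩
    have hσ := hlink σ (by simp)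
    have ih := ih (fun τ hτ => hlink τ (by simp [hτ])) hmin.1.2
    have hlen' := hmin.1.2
    simp only [List.length_append, List.length_singleton, wordProd_append, wordProd_cons,
      wordProd_nil, mul_one] at hlen ⊢
    generalize wordProd k F l = c at *
    have hcσ : c⁻¹ ∈ Half (invSym σ) 1 := mem_of_len_lt_len_mul_sym (by omega)
    rw [← mul_assoc, len_mul_sym_of_mem (q := q * c), ih]
    · omega
    by_contra hy
    obtain ⟨d, hd, e⟩ := cross_dist hy hcσ
    have e2 : (d⁻¹ * c⁻¹) * c ∈ linkGrp F (invSym σ).1 := by simpa using hd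
    rw [dist_comm _ (c⁻¹), dist_comm] at e
    simp only [dist, one_mul, sym_invSym, inv_inv] at e
    have h1 := len_mul_le (q * c * (d * sym k F σ)) ((sym k F σ)⁻¹ * d⁻¹)
    have h2 := len_mul_le (sym k F σ)⁻¹ d⁻¹
    have h3 := len_sym_le (F := F) σ
    have h5 := len_inv (c * d)
    have h6 := len_mul_le (d⁻¹ * c⁻¹) c
    simp only [mul_inv_rev, mul_assoc, mul_inv_cancel_left, inv_mul_cancel, mul_one,
      mul_inv_cancel, len_inv] at *
    have hmem := mem_linkGrp_of_len_mul (x := d⁻¹ * c⁻¹) (y := c)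
      (by simp only [mul_assoc, inv_mul_cancel, mul_one, len_inv]; omega)
      (by simpa [mul_assoc] using hd)
    have hcomm := (sym_commute (α := σ) hmem).eq
    have h7 := len_mul_sym_of_mem (hq (invSym σ) (link_invSym hσ))
    have h8 : q * sym k F σ = (q * (c * (d * sym k F σ))) * (d⁻¹ * c⁻¹) := by
      have : q * (c * (d * sym k F σ)) * (d⁻¹ * c⁻¹)
        = q * (c * d) * (sym k F σ * (d⁻¹ * c⁻¹)) := by group
      rw [this, hcomm]; group
    have h9 := len_mul_le (q * (c * (d * sym k F σ))) (d⁻¹ * c⁻¹)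
    rw [← h8] at h9
    omega

/-! ### Counting a symbol -/

open Classical in
/-- The minimal number of occurrences of `α` in a word representing `x`. -/
noncomputable def symMin (α : Fin k × Bool) (x : Grp k F) : ℕ :=
  sInf {n | ∃ l : List (Fin k × Bool), wordProd k F l = x ∧ l.count α = n}

open Classical in
lemma exists_count_eq_symMin (α : Fin k × Bool) (x : Grp k F) :
    ∃ l : List (Fin k × Bool), wordProd k F l = x ∧ l.count α = symMin α x := by
  obtain ⟨l, hl⟩ := exists_wordProd x
  exact Nat.sInf_mem
    (s := {n | ∃ l : List (Fin k × Bool), wordProd k F l = x ∧ l.count α = n}) ⟨_, l, hl, rfl⟩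

open Classical in
lemma symMin_wordProd_le (l : List (Fin k × Bool)) : symMin α (wordProd k F l) ≤ l.count α :=
  Nat.sInf_le ⟨l, rfl, rfl⟩

lemma symMin_mul_le (x y : Grp k F) : symMin α (x * y) ≤ symMin α x + symMin α y := by
  obtain ⟨l, rfl, hl⟩ := exists_count_eq_symMin α x
  obtain ⟨m, rfl, hm⟩ := exists_count_eq_symMin α y
  rw [← hl, ← hm, ← List.count_append, ← wordProd_append]
  exact symMin_wordProd_le _

lemma symMin_le_len (x : Grp k F) : symMin α x ≤ len x := by
  obtain ⟨l, rfl, hl⟩ := exists_minWord x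
  rw [← hl]
  exact (symMin_wordProd_le l).trans List.count_le_length

lemma symMin_sym_of_ne {σ : Fin k × Bool} (h : σ ≠ α) : symMin α (sym k F σ) = 0 := by
  simpa [h] using symMin_wordProd_le (F := F) (α := α) [σ]

lemma symMin_of_mem {c : Grp k F} (hc : c ∈ linkGrp F α.1) : symMin α c = 0 := by
  obtain ⟨l, rfl, hl⟩ := exists_minWord c
  refine Nat.le_zero.mp ((symMin_wordProd_le l).trans_eq (List.count_eq_zero.mpr fun h => ?_))
  exact (MinWord.forall_link ⟨rfl, hl⟩ hc α h).1 rfl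

lemma symMin_mul_right {c : Grp k F} (x : Grp k F) (hc : c ∈ linkGrp F α.1) :
    symMin α (x * c) = symMin α x := by
  have h1 := symMin_mul_le (α := α) x c
  have h2 := symMin_mul_le (α := α) (x * c) c⁻¹
  rw [symMin_of_mem hc] at h1
  rw [symMin_of_mem (inv_mem hc), mul_inv_cancel_right] at h2
  omega

lemma symMin_mul_left {c : Grp k F} (x : Grp k F) (hc : c ∈ linkGrp F α.1) :
    symMin α (c * x) = symMin α x := by
  have h1 := symMin_mul_le (α := α) c x
  have h2 := symMin_mul_le (α := α) c⁻¹ (c * x)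
  rw [symMin_of_mem hc] at h1
  rw [symMin_of_mem (inv_mem hc), inv_mul_cancel_left] at h2
  omega

lemma symMin_cross {g y v : Grp k F} (h1 : y ∉ Half α g) (h2 : v ∈ Half α g) :
    ∃ c ∈ linkGrp F α.1, symMin α (y⁻¹ * (g * c * (sym k F α)⁻¹)) + 1 +
      symMin α ((g * c)⁻¹ * v) ≤ symMin α (y⁻¹ * v) := by
  obtain ⟨l, hl, hlen⟩ := exists_count_eq_symMin α (y⁻¹ * v)
  obtain ⟨l₁, l₂, c, hc, rfl, e⟩ := exists_cross h1 (by rw [hl]; simpa using h2)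
  refine ⟨c, hc, ?_⟩
  have e1 : wordProd k F l₁ = y⁻¹ * (g * c * (sym k F α)⁻¹) := by rw [← e]; group
  have e2 : wordProd k F l₂ = (g * c)⁻¹ * v := by
    rw [← e, eq_inv_mul_iff_mul_eq, ← mul_right_inj y⁻¹, ← hl]; simp [mul_assoc]
  have h3 := symMin_wordProd_le (F := F) (α := α) l₁
  have h4 := symMin_wordProd_le (F := F) (α := α) l₂
  rw [e1] at h3
  rw [e2] at h4
  simp only [List.count_append, List.count_cons_self] at hlen
  omega

/-- The count of `α` is additive at a wall of `α`. -/
lemma symMin_add {g y z : Grp k F} (h1 : y ∉ Half α g) (h2 : z ∈ Half α g) :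
    symMin α (y⁻¹ * z) = symMin α (y⁻¹ * g) + symMin α (g⁻¹ * z) := by
  obtain ⟨c, hc, e⟩ := symMin_cross h1 h2
  have h3 := symMin_mul_le (α := α) (y⁻¹ * g) (g⁻¹ * z)
  have h4 := symMin_mul_le (α := α) (y⁻¹ * (g * c * (sym k F α)⁻¹)) (sym k F α)
  have h5 : symMin α (sym k F α) ≤ 1 := (symMin_le_len _).trans (len_sym_le _)
  have h6 := symMin_mul_right (y⁻¹ * g) hc
  have h7 := symMin_mul_left (g⁻¹ * z) (inv_mem hc)
  simp only [mul_assoc, mul_inv_rev, inv_mul_cancel, mul_one, mul_inv_cancel_left] at *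
  omega

lemma one_le_symMin {g y : Grp k F} (h1 : y ∉ Half α g) : 1 ≤ symMin α (y⁻¹ * g) := by
  obtain ⟨c, hc, e⟩ := symMin_cross h1 (self_mem_half g)
  omega

open Classical in
/-- A reduced word contains a symbol as rarely as possible. -/
lemma MinWord.count_le {l : List (Fin k × Bool)} {x : Grp k F} (h : MinWord x l) :
    l.count α ≤ symMin α x := by
  obtain ⟨rfl, hlen⟩ := h
  induction l using List.reverseRecOn with
  | nil => simp
  | append_singleton l σ ih =>
    have hmin := MinWord.of_append (x := wordProd k F (l ++ [σ])) ⟨rfl, hlen⟩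
    have ih := ih hmin.1.2
    have hlen' := hmin.1.2
    have hx : wordProd k F (l ++ [σ]) = wordProd k F l * sym k F σ := by simp
    rw [hx] at hlen ⊢
    simp only [List.length_append, List.length_singleton] at hlen
    rw [List.count_append]
    generalize wordProd k F l = x at *
    have hσ : x⁻¹ ∈ Half (invSym σ) 1 := mem_of_len_lt_len_mul_sym (by omega)
    by_cases h1 : σ = α
    · subst h1
      have h2 : x⁻¹ ∉ Half σ (sym k F σ) := by
        rw [← mem_half_invSym]; simpa using hσ
      obtain ⟨c, hc, e⟩ := symMin_cross h2 (self_mem_half _)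
      rw [conj_mem_linkGrp hc, inv_inv, symMin_mul_right _ hc] at e
      simp only [List.count_singleton_self]
      omega
    rw [List.count_singleton, if_neg (by simpa using h1), add_zero]
    refine ih.trans ?_
    by_cases h2 : σ = invSym α
    · subst h2
      obtain ⟨m, hm, hm'⟩ := exists_count_eq_symMin α (x * sym k F (invSym α))
      have h3 : sym k F α * x⁻¹ ∉ Half (invSym α) 1 := by
        have := mem_half_invSym (α := invSym α) (g := 1) (y := sym k F α * x⁻¹)
        rw [← not_iff_not, not_not] at this
        rw [← this, not_not]
        simpa using mul_mem_half (t := sym k F α) (g := 1).mpr (by simpa using hσ)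
      obtain ⟨l₁, l₂, c, hc, rfl, e⟩ := exists_cross (l := m) h3 (by
        rw [hm]; simpa using self_mem_half (1 : Grp k F))
      have h4 : wordProd k F l₁ = x * c := by
        have := conj_mem_linkGrp (inv_mem hc)
        have e' : wordProd k F l₁ = x * ((sym k F (invSym α)) * c * (sym k F (invSym α))⁻¹) := by
          rw [eq_comm, ← mul_inv_eq_iff_eq_mul] at e
          rw [one_mul] at e
          rw [mul_assoc (sym k F (invSym α)), e, sym_invSym]; group
        rw [e', conj_mem_linkGrp hc]
      rw [← hm', List.count_append, ← symMin_mul_right (α := α) x hc, ← h4]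
      exact (symMin_wordProd_le l₁).trans (Nat.le_add_right _ _)
    · have h3 := symMin_mul_le (α := α) (x * sym k F σ) (sym k F (invSym σ))
      rw [symMin_sym_of_ne (by rintro rfl; simp at h2)] at h3
      simpa using h3

lemma symCount_le_symMin (x : Grp k F) : symCount α x ≤ symMin α x := by
  have h := exists_minWord x
  rw [symCount, dif_pos h]
  exact h.choose_spec.count_le

/-! ### Nested half-spaces -/

lemma symMin_chain {g g' o e : Grp k F} (hg : g' ∈ Half α g) (ho : o ∉ Half α g)
    (ho' : o ∉ Half α g') (he : e ∈ Half α g') :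
    symMin α (g⁻¹ * e) = symMin α (g⁻¹ * g') + symMin α (g'⁻¹ * e) := by
  by_cases h : g ∈ Half α g'
  · have h1 : Half α g' ⊆ Half α g := half_subset_half hg ho ho'
    have hC : g'⁻¹ * g ∈ linkGrp F α.1 :=
      inv_mul_mem_of_exit (fun h2 => self_mul_inv_notMem_half g (h1 h2)) h
    have hC' : g⁻¹ * g' ∈ linkGrp F α.1 := by simpa using inv_mem hC
    have h2 := symMin_mul_left (g'⁻¹ * e) hC'
    simp only [mul_assoc, mul_inv_cancel_left] at h2
    rw [h2, symMin_of_mem hC', zero_add]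
  · exact symMin_add h he

lemma half_subset_half_of_symMin_le {g g' o e : Grp k F} (ho : o ∉ Half α g)
    (ho' : o ∉ Half α g') (he : e ∈ Half α g) (he' : e ∈ Half α g')
    (h : symMin α (g⁻¹ * e) ≤ symMin α (g'⁻¹ * e)) : Half α g ⊆ Half α g' := by
  rcases mem_half_or_mem_half ho he he' with hg | hg
  · have h1 := symMin_chain hg ho ho' he'
    refine half_subset_half ?_ ho' ho
    by_contra h2
    have := one_le_symMin h2
    omega
  · exact half_subset_half hg ho' ho

/-- Elements of `linkGrp` that do not move the shortest representative of a coset across a wall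
fix this wall. -/
lemma Shortest.conj_mem {z p q t : Grp k F} (hz : 1 ∈ Half α z) (ho : p⁻¹ ∉ Half α z)
    (hp : Shortest α.1 p) (hq : Shortest α.1 q) (ht : t ∈ linkGrp F α.1)
    (htq : t * q⁻¹ ∉ Half α z) : z⁻¹ * t * z ∈ linkGrp F α.1 := by
  obtain ⟨l, hl⟩ := exists_minWord t
  have hlink := hl.forall_link ht
  obtain ⟨rfl, hlen⟩ := hl
  clear ht
  induction l with
  | nil => simp
  | cons τ l ih =>
    have hmin := MinWord.of_append (l := [τ]) (m := l) (x := wordProd k F (τ :: l))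
      ⟨rfl, hlen⟩
    have hτ := hlink τ (by simp)
    have hl : ∀ σ ∈ l, σ.1 ≠ α.1 ∧ s(α.1, σ.1) ∉ F := fun σ hσ => hlink σ (by simp [hσ])
    have hlen' := hmin.2.2
    have ht := wordProd_mem_linkGrp hlink
    have ht' := wordProd_mem_linkGrp hl
    rw [wordProd_cons] at htq ht hlen ⊢
    rw [List.length_cons] at hlen
    have h1 : wordProd k F l * q⁻¹ ∈ Half τ 1 := by
      have h2 := hq.len_mul (inv_mem ht)
      have h3 := hq.len_mul (inv_mem ht')
      simpa using mem_of_len_lt_len_mul_sym (q := q * (wordProd k F l)⁻¹) (σ := invSym τ) (by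
        rw [len_inv, mul_inv_rev, ← mul_assoc] at h2
        rw [sym_invSym, h2, h3, len_inv]
        omega)
    have h2 : p⁻¹ ∉ Half τ (sym k F τ) := by
      rw [← mem_half_invSym]
      simpa using hp _ (link_invSym hτ)
    obtain ⟨d, hd, e, -⟩ := cross_between h2
      (show sym k F τ * (wordProd k F l * q⁻¹) ∈ _ by simpa using mul_mem_half.mpr h1)
    rw [conj_mem_linkGrp hd, ← mul_assoc] at e
    obtain ⟨c, hc, -, e'⟩ := cross_between (notMem_half_of_between ho htq e) hz
    have hzc : z * c ∈ linkGrp F τ.1 := by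
      have h3 : z * c * ((z * c)⁻¹ * d) = d := by group
      refine mem_linkGrp_of_len_mul (y := (z * c)⁻¹ * d) ?_ (by rwa [h3])
      rw [h3]
      rw [dist_comm d, dist_comm (z * c) 1, dist_comm d] at e'
      simp only [dist, inv_one, one_mul] at e'
      omega
    have hcomm := (sym_commute hzc).eq
    have hconj : z⁻¹ * sym k F τ * z ∈ linkGrp F α.1 := by
      have : z⁻¹ * sym k F τ * z = c * sym k F τ * c⁻¹ := by
        have : z⁻¹ * sym k F τ * z = z⁻¹ * (sym k F τ * (z * c)) * c⁻¹ := by group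
        rw [this, hcomm]; group
      rw [this]
      exact mul_mem (mul_mem hc (sym_mem_linkGrp hτ)) (inv_mem hc)
    have hH : Half α ((sym k F τ)⁻¹ * z) = Half α z :=
      half_eq_of_mem (by simpa [mul_assoc] using inv_mem hconj)
    have h3 : wordProd k F l * q⁻¹ ∉ Half α z := by
      rw [← hH, ← mul_mem_half (t := sym k F τ)]
      simpa [mul_assoc] using htq
    have := mul_mem hconj (ih hl h3 hlen')
    simpa [mul_assoc] using this

/-! ### Elements translating a half-space into itself -/

/-- `u` maps the half-space of `1` into itself, but not onto itself. -/
structure Translates (α : Fin k × Bool) (u : Grp k F) : Prop where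
  mul_mem : ∀ y ∈ Half α (1 : Grp k F), u * y ∈ Half α (1 : Grp k F)
  inv_notMem : u⁻¹ ∉ Half α (1 : Grp k F)

namespace Translates

variable {u : Grp k F}

lemma of_mem {o : Grp k F} (hu : u ∈ Half α 1) (hC : u ∉ linkGrp F α.1) (ho : o ∉ Half α 1)
    (ho' : u⁻¹ * o ∉ Half α 1) : Translates α u := by
  have hsub : Half α u ⊆ Half α 1 := half_subset_half hu ho (by rwa [mem_half_iff])
  refine ⟨fun y hy => hsub (by rw [mem_half_iff]; simpa using hy), fun h => hC ?_⟩
  have h1 := inv_mul_mem_of_exit (g := u) (y := 1)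
    (fun h2 => self_mul_inv_notMem_half 1 (hsub h2)) (by rw [mem_half_iff]; simpa using h)
  simpa using h1

lemma pow_mul_mem (hu : Translates α u) (n : ℕ) {y : Grp k F} (hy : y ∈ Half α 1) :
    u ^ n * y ∈ Half α 1 := by
  induction n with
  | zero => simpa using hy
  | succ n ih => rw [pow_succ', mul_assoc]; exact hu.mul_mem _ ih

lemma symMin_mul (hu : Translates α u) {y : Grp k F} (hy : y ∈ Half α 1) :
    symMin α (u * y) = symMin α u + symMin α y := by
  simpa using symMin_add hu.inv_notMem hy

lemma symMin_pow_mul (hu : Translates α u) (n : ℕ) {y : Grp k F} (hy : y ∈ Half α 1) :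
    symMin α (u ^ n * y) = n * symMin α u + symMin α y := by
  induction n with
  | zero => simp
  | succ n ih =>
    rw [pow_succ', mul_assoc, hu.symMin_mul (hu.pow_mul_mem n hy), ih]; ring

lemma pow_mem (hu : Translates α u) (n : ℕ) : u ^ n ∈ Half α 1 := by
  simpa using hu.pow_mul_mem n (self_mem_half 1)

lemma symMin_pow (hu : Translates α u) (n : ℕ) : symMin α (u ^ n) = n * symMin α u := by
  simpa [symMin_of_mem (one_mem (linkGrp F α.1))] using hu.symMin_pow_mul n (self_mem_half 1)

lemma one_le_symMin (hu : Translates α u) : 1 ≤ symMin α u := by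
  simpa using GraphGroupPaper.one_le_symMin hu.inv_notMem

lemma exists_pow_mul_mem (hu : Translates α u) (y : Grp k F) : ∃ n : ℕ, u ^ n * y ∈ Half α 1 := by
  by_contra! h
  have h1 := h (symMin α y⁻¹ + 1)
  generalize hn : symMin α y⁻¹ + 1 = n at h1
  have h2 := symMin_add (g := (u ^ n)⁻¹) (y := y) (z := 1) (by rwa [mem_half_iff, inv_inv])
    (by rw [mem_half_iff]; simpa using hu.pow_mem n)
  simp only [mul_one, inv_inv] at h2
  rw [hu.symMin_pow] at h2
  have := Nat.le_mul_of_pos_right n hu.one_le_symMin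
  omega

lemma exists_inv_pow_mul_notMem (hu : Translates α u) (y : Grp k F) :
    ∃ n : ℕ, (u ^ n)⁻¹ * y ∉ Half α 1 := by
  by_contra! h
  have h1 := h (symMin α (u * y) + 1)
  generalize hn : symMin α (u * y) + 1 = n at h1
  have h2 := symMin_add (g := u ^ n) (y := u⁻¹) (z := y) (fun h3 => hu.inv_notMem (by
    rw [mem_half_iff] at h3; simpa using hu.pow_mul_mem n h3)) (by rwa [mem_half_iff])
  rw [inv_inv, hu.symMin_mul (hu.pow_mem n), hu.symMin_pow] at h2
  have := Nat.le_mul_of_pos_right n hu.one_le_symMin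
  omega

/-- Every point can be translated to a point between two given consecutive walls. -/
lemma exists_conj_eq (hu : Translates α u) (x : Grp k F) : ∃ y, y⁻¹ * u * y = x⁻¹ * u * x ∧
    u * y ∉ Half α 1 ∧ u * (u * y) ∈ Half α 1 := by
  classical
  obtain ⟨n, hn⟩ := hu.exists_inv_pow_mul_notMem x
  have hex := hu.exists_pow_mul_mem ((u ^ n)⁻¹ * x)
  obtain ⟨m, hm⟩ : ∃ m, Nat.find hex = m + 1 :=
    Nat.exists_eq_succ_of_ne_zero fun h => hn (by simpa [h] using Nat.find_spec hex)
  have h1 := Nat.find_spec hex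
  have h2 := Nat.find_min hex (m := m) (by omega)
  rw [hm] at h1
  refine ⟨u⁻¹ * (u ^ m * ((u ^ n)⁻¹ * x)), by group, by simpa using h2, ?_⟩
  rwa [mul_inv_cancel_left, ← mul_assoc, ← pow_succ']

end Translates

/-! ### Segments of conjugates -/

lemma segment_of_between {c y v w : Grp k F} (h1 : dist y v + dist v w = dist y w)
    (h2 : dist y w + dist w (y * c) = dist y (y * c)) : Segment (v⁻¹ * w) c := by
  refine ⟨y⁻¹ * v, w⁻¹ * (y * c), by group, ?_⟩
  unfold dist at *
  rw [inv_mul_cancel_left] at h2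
  omega

/-- The point on a wall between `y` and `z` that is closest to `y`. -/
lemma exists_gate {g y z : Grp k F} (hy : y ∉ Half α g) (hz : z ∈ Half α g) :
    ∃ t ∈ linkGrp F α.1, Shortest α.1 (y⁻¹ * (g * t)) ∧
      dist y (g * t) + dist (g * t) z = dist y z := by
  classical
  have hex : ∃ n, ∃ t ∈ linkGrp F α.1, len (y⁻¹ * (g * t)) = n := ⟨_, 1, one_mem _, rfl⟩
  obtain ⟨t, ht, hn⟩ := Nat.find_spec hex
  have hs : Shortest α.1 (y⁻¹ * (g * t)) := .of_le fun c hc => by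
    rw [hn]
    exact Nat.find_min' hex ⟨t * c, mul_mem ht hc, by simp only [mul_assoc]⟩
  refine ⟨t, ht, hs, ?_⟩
  obtain ⟨c, hc, -, e⟩ := cross_between hy hz
  have h1 := hs.len_mul (mul_mem (inv_mem ht) hc)
  have h2 : y⁻¹ * (g * t) * (t⁻¹ * c) = y⁻¹ * (g * c) := by group
  have h3 : (g * t)⁻¹ * (g * c) = t⁻¹ * c := by group
  rw [h2, ← h3] at h1
  have h4 := dist_triangle (g * t) (g * c) z
  have h5 := dist_triangle y (g * t) z
  unfold dist at *
  omega

lemma mem_half_of_symMin_le {h h' o y : Grp k F} (ho : h * o ∉ Half α 1)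
    (ho' : h' * o ∉ Half α 1) (hh : h ∈ Half α 1) (hh' : h' ∈ Half α 1)
    (hle : symMin α h ≤ symMin α h') (hy : h * y ∈ Half α 1) : h' * y ∈ Half α 1 := by
  have := half_subset_half_of_symMin_le (g := h⁻¹) (g' := h'⁻¹) (o := o) (e := 1) (α := α)
    (by rwa [mem_half_iff, inv_inv]) (by rwa [mem_half_iff, inv_inv])
    (by rw [mem_half_iff]; simpa using hh) (by rw [mem_half_iff]; simpa using hh')
    (by simpa using hle) (a := y) (by rwa [mem_half_iff, inv_inv])
  rwa [mem_half_iff, inv_inv] at this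

/-- If sufficiently many walls separate `p⁻¹` from `1`, then conjugates of `u` have segments that
agree with `u` up to few occurrences of `α`. -/
lemma exists_segment {p u v : Grp k F} (hp : Shortest α.1 p) (hu : Translates α u)
    (hv : Translates α v) (huv : 2 * symMin α v < symMin α u)
    (ho : ∀ i ≤ 2, ∀ j ≤ 2 * symMin α u, v ^ j * (u ^ i * p⁻¹) ∉ Half α 1) (x : Grp k F) :
    ∃ s, Segment s (x⁻¹ * u * x) ∧ symMin α (u * s⁻¹) ≤ 2 * symMin α v := by
  classical
  obtain ⟨y, hyx, hy1, hy2⟩ := hu.exists_conj_eq x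
  rw [← hyx]
  have hv1 := hv.one_le_symMin
  have hy0 : y ∉ Half α 1 := fun h => hy1 (hu.mul_mem _ h)
  have compare : ∀ i ≤ 2, ∀ i' ≤ 2, ∀ j ≤ 2 * symMin α u, ∀ j' ≤ 2 * symMin α u,
      j * symMin α v + i * symMin α u ≤ j' * symMin α v + i' * symMin α u →
      v ^ j * (u ^ i * y) ∈ Half α 1 → v ^ j' * (u ^ i' * y) ∈ Half α 1 := by
    intro i hi i' hi' j hj j' hj' hle h
    rw [← mul_assoc] at h ⊢
    refine mem_half_of_symMin_le (o := p⁻¹) ?_ ?_ (hv.pow_mul_mem j (hu.pow_mem i))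
      (hv.pow_mul_mem j' (hu.pow_mem i')) ?_ h
    · rw [mul_assoc]; exact ho i hi j hj
    · rw [mul_assoc]; exact ho i' hi' j' hj'
    · rwa [hv.symMin_pow_mul _ (hu.pow_mem _), hv.symMin_pow_mul _ (hu.pow_mem _),
        hu.symMin_pow, hu.symMin_pow]
  have hle1 : symMin α u ≤ symMin α u * symMin α v := Nat.le_mul_of_pos_right _ hv1
  have e1 : v ^ (2 * symMin α u) * y ∈ Half α 1 := by
    simpa using compare 2 le_rfl 0 (by omega) 0 (by omega) _ le_rfl (by nlinarith)
      (by simpa [pow_two, mul_assoc] using hy2)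
  have e2 : v ^ symMin α u * (u * y) ∈ Half α 1 := by
    simpa using compare 2 le_rfl 1 (by omega) 0 (by omega) _ (by omega) (by nlinarith)
      (by simpa [pow_two, mul_assoc] using hy2)
  have hex1 : ∃ n, v ^ n * y ∈ Half α 1 := ⟨_, e1⟩
  have hex2 : ∃ n, v ^ n * (u * y) ∈ Half α 1 := ⟨_, e2⟩
  obtain ⟨j, hj⟩ : ∃ j, Nat.find hex1 = j + 1 :=
    Nat.exists_eq_succ_of_ne_zero fun h => hy0 (by simpa [h] using Nat.find_spec hex1)
  obtain ⟨n, hn⟩ : ∃ n, Nat.find hex2 = n + 1 :=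
    Nat.exists_eq_succ_of_ne_zero fun h => hy1 (by simpa [h] using Nat.find_spec hex2)
  have hj1 := Nat.find_spec hex1
  have hn1 := Nat.find_spec hex2
  have hj2 := Nat.find_min hex1 (m := j) (by omega)
  have hn2 := Nat.find_min hex2 (m := n) (by omega)
  have hjle := Nat.find_min' hex1 e1
  have hnle := Nat.find_min' hex2 e2
  rw [hj] at hj1 hjle
  rw [hn] at hn1 hnle
  have ineq1 : n * symMin α v + symMin α u < (j + 1) * symMin α v := by
    by_contra! h
    refine hn2 ?_
    simpa using compare 0 (by omega) 1 (by omega) (j + 1) (by omega) n (by omega)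
      (by simpa using h) (by simpa using hj1)
  have ineq2 : j * symMin α v < (n + 1) * symMin α v + symMin α u := by
    by_contra! h
    refine hj2 ?_
    simpa using compare 1 (by omega) 0 (by omega) (n + 1) (by omega) j (by omega)
      (by simpa using h) (by simpa using hn1)
  obtain ⟨m, rfl⟩ : ∃ m, j = n + 1 + m := Nat.exists_eq_add_of_le (by nlinarith)
  have hm1 : m * symMin α v < symMin α u := by nlinarith
  have hm2 : symMin α u < m * symMin α v + 2 * symMin α v := by nlinarith
  have hpow : v ^ (n + 1 + m) = v ^ m * v ^ (n + 1) := by rw [← pow_add, add_comm]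
  have hyn : v ^ (n + 1) * y ∉ Half α 1 := fun h => hj2 (by
    rw [hpow, mul_assoc]; exact hv.pow_mul_mem m h)
  obtain ⟨t, ht, hs, hw⟩ := exists_gate (g := (v ^ (n + 1))⁻¹) (y := y) (z := u * y)
    (by rwa [mem_half_iff, inv_inv]) (by rwa [mem_half_iff, inv_inv])
  obtain ⟨c, hc, -, hvw⟩ := cross_between (g := (v ^ (n + 1 + m))⁻¹) (y := y)
    (v := (v ^ (n + 1))⁻¹ * t) (by rwa [mem_half_iff, inv_inv]) (by
      rw [mem_half_iff, inv_inv, hpow, mul_assoc, mul_inv_cancel_left]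
      exact hv.pow_mul_mem m (mem_half_of_mem (by simpa using ht)))
  refine ⟨_, segment_of_between hvw (by simpa [mul_assoc] using hw), ?_⟩
  have hone : (1 : Grp k F) ∈ Half α (v ^ m)⁻¹ := by
    rw [mem_half_iff]; simpa using hv.pow_mem m
  have hop : p⁻¹ ∉ Half α (v ^ m)⁻¹ := by
    rw [mem_half_iff, inv_inv]; simpa using ho 0 (by omega) m (by omega)
  have hone' : (1 : Grp k F) ∈ Half α u⁻¹ := by
    rw [mem_half_iff]; simpa using hu.pow_mem 1
  have hop' : p⁻¹ ∉ Half α u⁻¹ := by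
    rw [mem_half_iff, inv_inv]; simpa using ho 1 (by omega) 0 (by omega)
  have hfix := hp.conj_mem hone hop hs ht (by
    rw [mem_half_iff]
    rw [hpow] at hj2
    simpa [mul_assoc] using hj2)
  have e3 : u * (((v ^ (n + 1 + m))⁻¹ * c)⁻¹ * ((v ^ (n + 1))⁻¹ * t))⁻¹ =
      u * (v ^ m)⁻¹ * (((v ^ m)⁻¹)⁻¹ * t * (v ^ m)⁻¹)⁻¹ * c := by
    rw [hpow]; group
  rw [e3, symMin_mul_right _ hc, symMin_mul_right _ (inv_mem hfix)]
  rcases mem_half_or_mem_half hop' hone' hone with h | h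
  · have := symMin_chain h hop' hop hone
    simp only [inv_inv, mul_one, hv.symMin_pow] at this
    omega
  · have := symMin_chain h hop hop' hone'
    simp only [inv_inv, mul_one, hv.symMin_pow] at this
    omega

lemma AlphaPeak.one_notMem {p : Grp k F} (hp : AlphaPeak α p) : (1 : Grp k F) ∉ Half α p := by
  rw [mem_half_iff, mul_one]; exact hp.inv_notMem

lemma AlphaPeak.len_le {p g : Grp k F} (hp : AlphaPeak α p) (hg : g ∈ Half α p) :
    len p ≤ len g := by
  obtain ⟨c, hc, -, e⟩ := cross_between hp.one_notMem hg
  have := hp.shortest.len_mul hc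
  simp only [dist, inv_one, one_mul] at e
  omega

lemma AlphaPeak.inv_mul_notMem {p g : Grp k F} (hp : AlphaPeak α p) (hg : len g < len p) :
    p⁻¹ * g ∉ Half α 1 := by
  rw [← mem_half_iff]
  intro h
  have := hp.len_le h
  omega

lemma len_conj_le {p a : Grp k F} (h : le p (a * p)) : len (p⁻¹ * (a * p)) ≤ len a := by
  have := len_mul_le a p
  unfold le at h
  omega

lemma AlphaPeak.conj_mem_half {p a : Grp k F} (hp : AlphaPeak α p) (h : le p (a * p)) :
    p⁻¹ * (a * p) ∈ Half α 1 := by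
  by_contra hu
  have h1 := dist_of_notMem_half hu
  have h2 := dist_of_notMem_half hp.inv_notMem
  rw [dist_comm, dist_comm _ p⁻¹] at h2
  have h3 := len_mul_le (p * (sym k F α)⁻¹) (sym k F α * (p⁻¹ * (a * p)))
  have h4 : p * (sym k F α)⁻¹ * (sym k F α * (p⁻¹ * (a * p))) = a * p := by group
  unfold le at h
  simp only [dist, inv_one, one_mul, inv_inv, mul_one, h4] at h1 h2 h3
  omega

lemma AlphaPeak.translates {p a : Grp k F} (hp : AlphaPeak α p) (h : le p (a * p))
    (hlen : len a < len p) (hpos : 0 < symMin α (p⁻¹ * (a * p))) :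
    Translates α (p⁻¹ * (a * p)) := by
  refine .of_mem (o := p⁻¹ * a) (hp.conj_mem_half h) (fun hC => ?_) (hp.inv_mul_notMem hlen) ?_
  · rw [symMin_of_mem hC] at hpos
    exact hpos.false
  · simpa [mul_assoc] using hp.inv_notMem

end

/-- if `p` is an `α`-peak with `p ≤ ap`, `p ≤ a'p`, `α` occurs in
`p⁻¹a'p`, and `|p| ≥ 8|a|³`, then each conjugate of `a` has a segment `s` with
`#_α(p⁻¹aps⁻¹) ≤ 2|a'|²`. -/
theorem stmt19 {k : ℕ} (hk : 1 ≤ k) {F : Set (Sym2 (Fin k))}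
    (α : Fin k × Bool) (p a a' : Grp k F)
    (hp : AlphaPeak α p)
    (h1 : le p (a * p)) (h2 : le p (a' * p))
    (hα : Occurs α (p⁻¹ * (a' * p)))
    (hlen : 8 * (len a) ^ 3 ≤ len p) :
    ∀ c x : Grp k F, c = x⁻¹ * a * x →
      ∃ s : Grp k F, Segment s c ∧
        symCount α (p⁻¹ * (a * p) * s⁻¹) ≤ 2 * (len a') ^ 2 := by
  rintro c x rfl
  set u := p⁻¹ * (a * p) with hu
  set v := p⁻¹ * (a' * p) with hv
  by_cases hsmall : symMin α u ≤ 2 * len a' ^ 2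
  · refine ⟨1, ⟨1, x⁻¹ * a * x, by simp, by simp⟩, (symCount_le_symMin _).trans ?_⟩
    rwa [inv_one, mul_one]
  have hua : symMin α u ≤ len a := (symMin_le_len u).trans (len_conj_le h1)
  have hva : symMin α v ≤ len a' := (symMin_le_len v).trans (len_conj_le h2)
  have hv0 : 0 < symMin α v := lt_of_lt_of_le hα (symCount_le_symMin _)
  have hsq : len a' ≤ len a' ^ 2 := Nat.le_self_pow two_ne_zero _
  have ha'a : len a' ≤ len a := by omega
  have ha : 1 ≤ len a := by omega
  have hcube : len a ^ 2 ≤ len a ^ 3 := Nat.pow_le_pow_right ha (by omega)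
  have hsq' : len a ≤ len a ^ 2 := Nat.le_self_pow two_ne_zero _
  have hupos : 0 < symMin α u := by omega
  have hut : Translates α u := hp.translates h1 (by omega) hupos
  have hvt : Translates α v := hp.translates h2 (by omega) hv0
  obtain ⟨s, hs, hs'⟩ := exists_segment hp.shortest hut hvt (by omega) (by
    intro i hi j hj
    have e : v ^ j * (u ^ i * p⁻¹) = p⁻¹ * (a' ^ j * a ^ i) := by
      have e1 : u = p⁻¹ * a * p⁻¹⁻¹ := by rw [hu]; group
      have e2 : v = p⁻¹ * a' * p⁻¹⁻¹ := by rw [hv]; group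
      rw [e1, e2, conj_pow, conj_pow]; group
    rw [e]
    refine hp.inv_mul_notMem ?_
    have l1 := len_mul_le (a' ^ j) (a ^ i)
    have l2 := len_pow_le a' j
    have l3 := len_pow_le a i
    have l4 : j * len a' ≤ 2 * len a * len a := Nat.mul_le_mul (by omega) ha'a
    have l5 : i * len a ≤ 2 * len a := Nat.mul_le_mul_right _ hi
    nlinarith) (p⁻¹ * x)
  refine ⟨s, ?_, (symCount_le_symMin _).trans (hs'.trans (by omega))⟩
  have e : (p⁻¹ * x)⁻¹ * u * (p⁻¹ * x) = x⁻¹ * a * x := by rw [hu]; group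
  rwa [e] at hs

end GraphGroupPaper
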